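/- (Lemma, Section 2) Let N ≥ 1, let F, H_1, …, H_N, K_1, …, K_N : ℝ^{2n} → ℝ be smooth, and let τ ∈ ℝ. Define 𝒜(v) = ∫₀¹ [ p(t)·q̇(t) − F(v(t)) − Σ_{i=1}^N H_i(v(t)) K_i(v(t−τ)) ] dt on loops v = (q,p). Then every critical point v of 𝒜 satisfies the Hamiltonian delay equation v̇(t) = X_F(v(t)) + Σ_{i=1}^N [ H_i(v(t+τ)) X_{K_i}(v(t)) + K_i(v(t−τ)) X_{H_i}(v(t)) ] for all t ∈ ℝ. -/

import Mathlib

open MeasureTheory intervalIntegral Real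

noncomputable section

/-- Phase space ℝ^{2n}, with points written v = (q, p). -/
abbrev Phase (n : ℕ) := (Fin n → ℝ) × (Fin n → ℝ)

/-- The standard symplectic form ω(u,w) = Σ_j (u^q_j w^p_j − u^p_j w^q_j). -/
def symForm {n : ℕ} (u w : Phase n) : ℝ :=
  ∑ j, (u.1 j * w.2 j - u.2 j * w.1 j)

/-- The Hamiltonian vector field X_H = (∂H/∂p, −∂H/∂q). -/
def hamVF {n : ℕ} (H : Phase n → ℝ) (x : Phase n) : Phase n :=
  (fun i => fderiv ℝ H x (0, Pi.single i 1),
   fun i => -fderiv ℝ H x (Pi.single i 1, 0))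

/-- A loop is a smooth 1-periodic map ℝ → ℝ^{2n}. -/
def IsLoop {n : ℕ} (v : ℝ → Phase n) : Prop :=
  ContDiff ℝ (⊤ : ℕ∞) v ∧ ∀ t, v (t + 1) = v t

/-- First variation of a functional 𝒜 at v in direction v̂. -/
def firstVariation {n : ℕ} (A : (ℝ → Phase n) → ℝ) (v vh : ℝ → Phase n) : ℝ :=
  deriv (fun s : ℝ => A (fun t => v t + s • vh t)) 0

/-- v is a critical point of 𝒜 if the first variation vanishes in all loop directions. -/
def IsCritPt {n : ℕ} (A : (ℝ → Phase n) → ℝ) (v : ℝ → Phase n) : Prop :=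
  ∀ vh, IsLoop vh → firstVariation A v vh = 0

end

/-- Differentiation under the integral sign for a jointly continuous partial derivative. -/
theorem hasDerivAt_intervalIntegral_of_continuous {f f' : ℝ → ℝ → ℝ} {a b : ℝ}
    (hf : ∀ s, Continuous (f s)) (hf' : Continuous (Function.uncurry f'))
    (h : ∀ s t, HasDerivAt (fun s => f s t) (f' s t) s) (s₀ : ℝ) :
    HasDerivAt (fun s => ∫ t in a..b, f s t) (∫ t in a..b, f' s₀ t) s₀ := by
  obtain ⟨C, hC⟩ := ((isCompact_closedBall s₀ 1).prod
    (isCompact_uIcc (a := a) (b := b))).exists_bound_of_continuousOn hf'.continuousOn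
  refine (intervalIntegral.hasDerivAt_integral_of_dominated_loc_of_deriv_le
    (F := f) (F' := f') (bound := fun _ => C) (Metric.closedBall_mem_nhds s₀ one_pos)
    (.of_forall fun s => (hf s).aestronglyMeasurable) ((hf s₀).intervalIntegrable _ _)
    (hf'.comp (by fun_prop : Continuous fun t : ℝ => (s₀, t))).aestronglyMeasurable
    (.of_forall fun t ht s hs => hC (s, t) ⟨hs, Set.uIoc_subset_uIcc ht⟩)
    intervalIntegrable_const (.of_forall fun t _ s _ => h s t)).2

section SymForm

variable {n : ℕ}

theorem symForm_add_left (u u' w : Phase n) : symForm (u + u') w = symForm u w + symForm u' w := by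
  simp only [symForm, ← Finset.sum_add_distrib, Prod.fst_add, Prod.snd_add, Pi.add_apply]
  exact Finset.sum_congr rfl fun _ _ => by ring

theorem symForm_smul_left (c : ℝ) (u w : Phase n) : symForm (c • u) w = c * symForm u w := by
  simp only [symForm, Finset.mul_sum, Prod.smul_fst, Prod.smul_snd, Pi.smul_apply, smul_eq_mul]
  exact Finset.sum_congr rfl fun _ _ => by ring

theorem symForm_sub_left (u u' w : Phase n) : symForm (u - u') w = symForm u w - symForm u' w := by
  simp only [symForm, ← Finset.sum_sub_distrib, Prod.fst_sub, Prod.snd_sub, Pi.sub_apply]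
  exact Finset.sum_congr rfl fun _ _ => by ring

theorem symForm_sum_left {ι : Type*} (s : Finset ι) (u : ι → Phase n) (w : Phase n) :
    symForm (∑ i ∈ s, u i) w = ∑ i ∈ s, symForm (u i) w := by
  classical
  induction s using Finset.induction_on with
  | empty => simp [symForm]
  | insert i s hi ih => rw [Finset.sum_insert hi, Finset.sum_insert hi, symForm_add_left, ih]

theorem symForm_hamVF (H : Phase n → ℝ) (x u : Phase n) :
    symForm (hamVF H x) u = fderiv ℝ H x u := by
  have hu : u = ∑ j, (u.1 j • ((Pi.single j 1, 0) : Phase n)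
      + u.2 j • ((0, Pi.single j 1) : Phase n)) := by
    ext k <;> simp [Prod.fst_sum, Prod.snd_sum, Finset.sum_apply, Pi.single_apply]
  conv_rhs => rw [hu]
  simp only [map_sum, map_add, map_smul, smul_eq_mul, symForm, hamVF]
  exact Finset.sum_congr rfl fun _ _ => by ring

/-- Pairing `u` with its rotation under the symplectic form gives the squared Euclidean norm. -/
theorem symForm_rotate (u : Phase n) :
    symForm u (-u.2, u.1) = ∑ j, (u.1 j ^ 2 + u.2 j ^ 2) := by
  simp only [symForm, Pi.neg_apply]
  exact Finset.sum_congr rfl fun _ _ => by ring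

theorem symForm_rotate_nonneg (u : Phase n) : 0 ≤ symForm u (-u.2, u.1) := by
  rw [symForm_rotate]
  positivity

theorem eq_zero_of_symForm_rotate_eq_zero {u : Phase n} (hu : symForm u (-u.2, u.1) = 0) :
    u = 0 := by
  rw [symForm_rotate, Finset.sum_eq_zero_iff_of_nonneg fun _ _ => by positivity] at hu
  ext j <;> simp only [Prod.fst_zero, Prod.snd_zero, Pi.zero_apply] <;>
    nlinarith [hu j (Finset.mem_univ j), sq_nonneg (u.1 j), sq_nonneg (u.2 j)]

theorem contDiff_hamVF {H : Phase n → ℝ} (hH : ContDiff ℝ (⊤ : ℕ∞) H) :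
    ContDiff ℝ (⊤ : ℕ∞) (hamVF H) := by
  have h : ContDiff ℝ (⊤ : ℕ∞) (fderiv ℝ H) := hH.fderiv_right (by simp)
  exact (contDiff_pi.2 fun i => h.clm_apply contDiff_const).prodMk
    (contDiff_pi.2 fun i => (h.clm_apply contDiff_const).neg)

theorem continuous_symForm : Continuous fun x : Phase n × Phase n => symForm x.1 x.2 := by
  unfold symForm
  fun_prop

end SymForm

section Action

variable {n N : ℕ}

/-- The action functional with delay `τ`. -/
noncomputable def delayAction (F : Phase n → ℝ) (H K : Fin N → Phase n → ℝ) (τ : ℝ) (w : ℝ → Phase n) : ℝ :=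
  ∫ t in (0:ℝ)..1,
    ((∑ j, (w t).2 j * (deriv w t).1 j) - F (w t) - ∑ i, H i (w t) * K i (w (t - τ)))

/-- The right-hand side of the Hamiltonian delay equation along `v`. -/
noncomputable def delayField (F : Phase n → ℝ) (H K : Fin N → Phase n → ℝ) (τ : ℝ) (v : ℝ → Phase n)
    (t : ℝ) : Phase n :=
  hamVF F (v t) + ∑ i, (H i (v (t + τ)) • hamVF (K i) (v t)
    + K i (v (t - τ)) • hamVF (H i) (v t))

theorem IsLoop.deriv_contDiff {v : ℝ → Phase n} (hv : IsLoop v) :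
    ContDiff ℝ (⊤ : ℕ∞) (deriv v) :=
  hv.1.iterate_deriv 1

theorem IsLoop.hasDerivAt {v : ℝ → Phase n} (hv : IsLoop v) (t : ℝ) :
    HasDerivAt v (deriv v t) t :=
  (hv.1.differentiable (by simp) t).hasDerivAt

theorem IsLoop.deriv_isLoop {v : ℝ → Phase n} (hv : IsLoop v) : IsLoop (deriv v) := by
  refine ⟨hv.deriv_contDiff, fun t => ?_⟩
  rw [← deriv_comp_add_const, funext hv.2]

theorem hasDerivAt_delayAction {F : Phase n → ℝ} {H K : Fin N → Phase n → ℝ}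
    (hF : ContDiff ℝ (⊤ : ℕ∞) F) (hH : ∀ i, ContDiff ℝ (⊤ : ℕ∞) (H i))
    (hK : ∀ i, ContDiff ℝ (⊤ : ℕ∞) (K i)) (τ : ℝ) {v u : ℝ → Phase n}
    (hv : IsLoop v) (hu : IsLoop u) :
    HasDerivAt (fun s : ℝ => delayAction F H K τ (fun t => v t + s • u t))
      (∫ t in (0:ℝ)..1, ((∑ j, ((u t).2 j * (deriv v t).1 j + (v t).2 j * (deriv u t).1 j))
        - fderiv ℝ F (v t) (u t)
        - ∑ i, (fderiv ℝ (H i) (v t) (u t) * K i (v (t - τ))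
          + H i (v t) * fderiv ℝ (K i) (v (t - τ)) (u (t - τ))))) 0 := by
  have hderiv : ∀ s t : ℝ, deriv (fun t => v t + s • u t) t = deriv v t + s • deriv u t :=
    fun s t => ((hv.hasDerivAt t).add ((hu.hasDerivAt t).const_smul s)).deriv
  have hv0 := hv.1.continuous
  have hu0 := hu.1.continuous
  have hv1 := hv.deriv_contDiff.continuous
  have hu1 := hu.deriv_contDiff.continuous
  have hF0 := hF.continuous
  have hH0 := fun i => (hH i).continuous
  have hK0 := fun i => (hK i).continuous
  have hF1 := hF.continuous_fderiv (by simp)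
  have hH1 := fun i => (hH i).continuous_fderiv (by simp)
  have hK1 := fun i => (hK i).continuous_fderiv (by simp)
  have hline : ∀ (x y : Phase n) (s : ℝ), HasDerivAt (fun s : ℝ => x + s • y) y s := fun x y s => by
    simpa using ((hasDerivAt_id s).smul_const y).const_add x
  have hcomp : ∀ {G : Phase n → ℝ}, ContDiff ℝ (⊤ : ℕ∞) G → ∀ (x y : Phase n) (s : ℝ),
      HasDerivAt (fun s : ℝ => G (x + s • y)) (fderiv ℝ G (x + s • y) y) s := fun hG x y s =>
    (hG.differentiable (by simp) _).hasFDerivAt.comp_hasDerivAt s (hline x y s)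
  have key := hasDerivAt_intervalIntegral_of_continuous (a := 0) (b := 1)
    (f := fun s t => (∑ j, (v t + s • u t).2 j * (deriv v t + s • deriv u t).1 j)
      - F (v t + s • u t) - ∑ i, H i (v t + s • u t) * K i (v (t - τ) + s • u (t - τ)))
    (f' := fun s t => (∑ j, ((u t).2 j * (deriv v t + s • deriv u t).1 j
        + (v t + s • u t).2 j * (deriv u t).1 j))
      - fderiv ℝ F (v t + s • u t) (u t)
      - ∑ i, (fderiv ℝ (H i) (v t + s • u t) (u t) * K i (v (t - τ) + s • u (t - τ))
        + H i (v t + s • u t) * fderiv ℝ (K i) (v (t - τ) + s • u (t - τ)) (u (t - τ))))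
    (fun s => by fun_prop) (by unfold Function.uncurry; fun_prop) (fun s t => ?_) 0
  · simpa only [delayAction, hderiv, zero_smul, add_zero] using key
  · refine ((HasDerivAt.fun_sum fun j _ => ?_).sub (hcomp hF _ _ _)).sub
      (HasDerivAt.fun_sum fun i _ => (hcomp (hH i) _ _ _).mul (hcomp (hK i) _ _ _))
    exact (hasDerivAt_pi.1 (hline (v t) (u t) s).snd j).mul
      (hasDerivAt_pi.1 (hline (deriv v t) (deriv u t) s).fst j)

theorem firstVariation_delayAction {F : Phase n → ℝ} {H K : Fin N → Phase n → ℝ}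
    (hF : ContDiff ℝ (⊤ : ℕ∞) F) (hH : ∀ i, ContDiff ℝ (⊤ : ℕ∞) (H i))
    (hK : ∀ i, ContDiff ℝ (⊤ : ℕ∞) (K i)) (τ : ℝ) {v u : ℝ → Phase n}
    (hv : IsLoop v) (hu : IsLoop u) :
    firstVariation (delayAction F H K τ) v u =
      ∫ t in (0:ℝ)..1, symForm (deriv v t - delayField F H K τ v t) (u t) := by
  rw [firstVariation, (hasDerivAt_delayAction hF hH hK τ hv hu).deriv]
  have hv0 := hv.1.continuous
  have hu0 := hu.1.continuous
  have hv1 := hv.deriv_contDiff.continuous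
  have hu1 := hu.deriv_contDiff.continuous
  have hF1 := hF.continuous_fderiv (by simp)
  have hH0 := fun i => (hH i).continuous
  have hK0 := fun i => (hK i).continuous
  have hH1 := fun i => (hH i).continuous_fderiv (by simp)
  have hK1 := fun i => (hK i).continuous_fderiv (by simp)
  -- the boundary term of the integration by parts
  set B' : ℝ → ℝ := fun t => ∑ j, ((deriv v t).2 j * (u t).1 j + (v t).2 j * (deriv u t).1 j)
    with hB'
  have hB'c : Continuous B' := by fun_prop
  have hB : ∫ t in (0:ℝ)..1, B' t = 0 := by
    rw [integral_eq_sub_of_hasDerivAt (f := fun t => ∑ j, (v t).2 j * (u t).1 j)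
      (fun t _ => HasDerivAt.fun_sum fun j _ => (hasDerivAt_pi.1 (hv.hasDerivAt t).snd j).mul
        (hasDerivAt_pi.1 (hu.hasDerivAt t).fst j)) (hB'c.intervalIntegrable _ _)]
    have hv_per := hv.2 0
    have hu_per := hu.2 0
    rw [zero_add] at hv_per hu_per
    simp [hv_per, hu_per]
  -- the delayed term, shifted by `τ`
  set g : ℝ → ℝ := fun t => ∑ i, H i (v (t + τ)) * fderiv ℝ (K i) (v t) (u t) with hg
  have hgc : Continuous g := by fun_prop
  have hgper : Function.Periodic g 1 := fun t => by
    simp only [hg, hv.2, hu.2, add_right_comm t 1 τ]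
  have hshift : ∫ t in (0:ℝ)..1, (g t - g (t - τ)) = 0 := by
    have h := hgper.intervalIntegral_add_eq 0 (0 - τ)
    rw [zero_add, show 0 - τ + 1 = 1 - τ by ring] at h
    rw [intervalIntegral.integral_sub (hgc.intervalIntegrable _ _)
      (Continuous.intervalIntegrable (by fun_prop) _ _),
      intervalIntegral.integral_comp_sub_right, h, sub_self]
  have hpt : ∀ t, symForm (deriv v t - delayField F H K τ v t) (u t) =
      ((∑ j, ((u t).2 j * (deriv v t).1 j + (v t).2 j * (deriv u t).1 j))
        - fderiv ℝ F (v t) (u t)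
        - ∑ i, (fderiv ℝ (H i) (v t) (u t) * K i (v (t - τ))
          + H i (v t) * fderiv ℝ (K i) (v (t - τ)) (u (t - τ)))) - B' t - (g t - g (t - τ)) := by
    intro t
    have h1 : symForm (deriv v t) (u t) =
        (∑ j, ((u t).2 j * (deriv v t).1 j + (v t).2 j * (deriv u t).1 j)) - B' t := by
      rw [hB', ← Finset.sum_sub_distrib]
      exact Finset.sum_congr rfl fun _ _ => by ring
    simp only [delayField, symForm_sub_left, symForm_add_left, symForm_sum_left, symForm_smul_left,
      symForm_hamVF, h1, hg, sub_add_cancel, Finset.sum_add_distrib]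
    simp only [mul_comm (K _ _)]
    ring
  simp only [hpt]
  symm
  rw [intervalIntegral.integral_sub, intervalIntegral.integral_sub, hB, hshift, sub_zero, sub_zero]
  all_goals exact Continuous.intervalIntegrable (by fun_prop) _ _

theorem isLoop_deriv_sub_delayField {F : Phase n → ℝ} {H K : Fin N → Phase n → ℝ}
    (hF : ContDiff ℝ (⊤ : ℕ∞) F) (hH : ∀ i, ContDiff ℝ (⊤ : ℕ∞) (H i))
    (hK : ∀ i, ContDiff ℝ (⊤ : ℕ∞) (K i)) (τ : ℝ) {v : ℝ → Phase n} (hv : IsLoop v) :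
    IsLoop fun t => deriv v t - delayField F H K τ v t := by
  refine ⟨hv.deriv_contDiff.sub (((contDiff_hamVF hF).comp hv.1).add (ContDiff.sum fun i _ =>
    ((((hH i).comp hv.1).comp (contDiff_id.add contDiff_const)).smul
      ((contDiff_hamVF (hK i)).comp hv.1)).add
    ((((hK i).comp hv.1).comp (contDiff_id.sub contDiff_const)).smul
      ((contDiff_hamVF (hH i)).comp hv.1)))), fun t => ?_⟩
  simp only [delayField, hv.deriv_isLoop.2, hv.2, add_right_comm t 1 τ, add_sub_right_comm t 1 τ]

end Action

theorem stmt5 {n N : ℕ} (hn : 1 ≤ n) (hN : 1 ≤ N)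
    (F : Phase n → ℝ) (H K : Fin N → Phase n → ℝ)
    (hF : ContDiff ℝ (⊤ : ℕ∞) F) (hH : ∀ i, ContDiff ℝ (⊤ : ℕ∞) (H i)) (hK : ∀ i, ContDiff ℝ (⊤ : ℕ∞) (K i))
    (τ : ℝ) (v : ℝ → Phase n) (hv : IsLoop v)
    (hcrit : IsCritPt
      (fun w => ∫ t in (0:ℝ)..1,
        ((∑ j, (w t).2 j * (deriv w t).1 j) - F (w t)
          - ∑ i, H i (w t) * K i (w (t - τ)))) v) :
    ∀ t : ℝ,
      deriv v t = hamVF F (v t)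
        + ∑ i, (H i (v (t + τ)) • hamVF (K i) (v t)
                 + K i (v (t - τ)) • hamVF (H i) (v t)) := by
  set e : ℝ → Phase n := fun t => deriv v t - delayField F H K τ v t with he
  have hloop : IsLoop e := isLoop_deriv_sub_delayField hF hH hK τ hv
  have hrot : IsLoop fun t => ((-(e t).2, (e t).1) : Phase n) :=
    ⟨hloop.1.snd.neg.prodMk hloop.1.fst, fun t => by simp only [hloop.2]⟩
  have hintegral : ∫ t in (0:ℝ)..1, symForm (e t) (-(e t).2, (e t).1) = 0 :=
    (firstVariation_delayAction hF hH hK τ hv hrot).symm.trans (hcrit _ hrot)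
  have hcont : Continuous fun t => symForm (e t) (-(e t).2, (e t).1) :=
    continuous_symForm.comp (hloop.1.continuous.prodMk hrot.1.continuous)
  have hzero : ∀ t ∈ Set.Icc (0:ℝ) 1, e t = 0 := by
    intro t ht
    by_contra hne
    refine (intervalIntegral.integral_pos one_pos hcont.continuousOn
      (fun s _ => symForm_rotate_nonneg _) ⟨t, ht, ?_⟩).ne' hintegral
    exact (symForm_rotate_nonneg _).lt_of_ne' fun h => hne (eq_zero_of_symForm_rotate_eq_zero h)
  intro t
  obtain ⟨s, hs, hts⟩ := Function.Periodic.exists_mem_Ico₀ (f := e) hloop.2 one_pos t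
  exact sub_eq_zero.1 (hts.trans (hzero s (Set.Ico_subset_Icc_self hs)))
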